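/- arXiv:2206.00550 — 9 statements merged into one kernel-verified Lean document; each statement's English description precedes it below -/
import Mathlib

section
/- If (A_l, B_l, C_l), l = 1,…,r, is a correct matrix multiplication scheme for n×n matrices over K, and U, V, W ∈ GL(n,K), then the scheme (U·A_l·V⁻¹, V·B_l·W⁻¹, W·C_l·U⁻¹), l = 1,…,r, is also correct. -/
open scoped BigOperators
open Matrix

/-- A matrix multiplication scheme `(A_l, B_l, C_l)`, `l = 1,…,r`, for `n×n` matrices over `K`
is correct if for all `X, Y` one has
`∑_l (∑_{i,j} (A_l)_{i,j} X_{i,j}) · (∑_{i,j} (B_l)_{i,j} Y_{i,j}) • C_l = (X·Y)ᵀ`. -/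
def IsCorrectScheme {K : Type*} [Field K] {n r : ℕ}
    (A B C : Fin r → Matrix (Fin n) (Fin n) K) : Prop :=
  ∀ X Y : Matrix (Fin n) (Fin n) K,
    ∑ l, ((∑ i, ∑ j, A l i j * X i j) * (∑ i, ∑ j, B l i j * Y i j)) • C l = (X * Y)ᵀ

/-- The entrywise pairing of two matrices is the trace of `S * Tᵀ`. -/
theorem sum_mul_eq_trace_mul_transpose {K m n : Type*} [CommSemiring K] [Fintype m] [Fintype n]
    (S T : Matrix m n K) : ∑ i, ∑ j, S i j * T i j = (S * Tᵀ).trace := by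
  simp [Matrix.trace, Matrix.mul_apply]

/-- The entrywise pairing `∑ i j, M i j * N i j` moves left and right factors of its first argument
to transposed factors of its second. -/
theorem sum_mul_mul_apply_mul {K m n p q : Type*} [CommSemiring K] [Fintype m] [Fintype n]
    [Fintype p] [Fintype q] (P : Matrix m p K) (M : Matrix p q K) (Q : Matrix q n K)
    (X : Matrix m n K) :
    ∑ i, ∑ j, (P * M * Q) i j * X i j = ∑ i, ∑ j, M i j * (Pᵀ * X * Qᵀ) i j := by
  rw [sum_mul_eq_trace_mul_transpose, sum_mul_eq_trace_mul_transpose,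
    Matrix.mul_assoc P M Q, Matrix.mul_assoc P (M * Q), Matrix.trace_mul_comm]
  simp [Matrix.transpose_mul, Matrix.mul_assoc]

/-- Correctness of a matrix multiplication scheme is preserved by the sandwiching action:
`(A,B,C) ↦ (U·A·V⁻¹, V·B·W⁻¹, W·C·U⁻¹)` with `U, V, W ∈ GL(n,K)`. -/
theorem sandwich_preserves_correctness (K : Type*) [Field K] (n r : ℕ)
    (hn : 1 ≤ n) (hr : 1 ≤ r)
    (A B C : Fin r → Matrix (Fin n) (Fin n) K)
    (h : IsCorrectScheme A B C) (U V W : GL (Fin n) K) :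
    IsCorrectScheme
      (fun l => (U : Matrix (Fin n) (Fin n) K) * A l *
        ((V⁻¹ : GL (Fin n) K) : Matrix (Fin n) (Fin n) K))
      (fun l => (V : Matrix (Fin n) (Fin n) K) * B l *
        ((W⁻¹ : GL (Fin n) K) : Matrix (Fin n) (Fin n) K))
      (fun l => (W : Matrix (Fin n) (Fin n) K) * C l *
        ((U⁻¹ : GL (Fin n) K) : Matrix (Fin n) (Fin n) K)) := by
  intro X Y
  have hV : ((V⁻¹ : GL (Fin n) K) : Matrix (Fin n) (Fin n) K)ᵀ *
      (V : Matrix (Fin n) (Fin n) K)ᵀ = 1 := by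
    rw [← Matrix.transpose_mul, Units.mul_inv, Matrix.transpose_one]
  have key : (U : Matrix (Fin n) (Fin n) K)ᵀ * X *
      ((V⁻¹ : GL (Fin n) K) : Matrix (Fin n) (Fin n) K)ᵀ *
      ((V : Matrix (Fin n) (Fin n) K)ᵀ * Y *
        ((W⁻¹ : GL (Fin n) K) : Matrix (Fin n) (Fin n) K)ᵀ) =
      (U : Matrix (Fin n) (Fin n) K)ᵀ * (X * Y) *
        ((W⁻¹ : GL (Fin n) K) : Matrix (Fin n) (Fin n) K)ᵀ := by
    simp only [Matrix.mul_assoc]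
    rw [← Matrix.mul_assoc _ _ (Y * _), hV, Matrix.one_mul]
  have e := congrArg (fun M => (W : Matrix (Fin n) (Fin n) K) * M *
    ((U⁻¹ : GL (Fin n) K) : Matrix (Fin n) (Fin n) K)) (h _ _ |>.trans (congrArg transpose key))
  simp only [Matrix.mul_sum, Matrix.sum_mul, Matrix.mul_smul, Matrix.smul_mul] at e
  simp only [sum_mul_mul_apply_mul]
  rw [e, Matrix.transpose_mul, Matrix.transpose_mul, Matrix.transpose_transpose,
    Matrix.transpose_transpose, Units.mul_inv_cancel_left, Units.mul_inv_cancel_right]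
end

section
/- If (A_l, B_l, C_l), l = 1,…,r, is a correct matrix multiplication scheme for n×n matrices over K, then the cyclically shifted scheme (B_l, C_l, A_l), l = 1,…,r, is also correct. -/
open scoped BigOperators
open Matrix

theorem Matrix.sum_sum_mul_single_one {K : Type*} [Field K] {n : ℕ}
    (M : Matrix (Fin n) (Fin n) K) (p q : Fin n) :
    ∑ i, ∑ j, M i j * single p q (1 : K) i j = M p q := by
  simp [single_apply, ite_and]

theorem Matrix.sum_smul_sum_sum_mul {K : Type*} [Field K] {n r : ℕ} (c : Fin r → K)
    (C : Fin r → Matrix (Fin n) (Fin n) K) (Z : Matrix (Fin n) (Fin n) K) :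
    ∑ i, ∑ j, (∑ l, c l • C l) i j * Z i j = ∑ l, c l * ∑ i, ∑ j, C l i j * Z i j := by
  simp only [Matrix.sum_apply, Matrix.smul_apply, smul_eq_mul, Finset.sum_mul, Finset.mul_sum,
    mul_assoc]
  rw [Finset.sum_comm]
  simp_rw [Finset.sum_comm (s := Finset.univ (α := Fin n)) (t := Finset.univ (α := Fin r))]
  exact Finset.sum_congr rfl fun l _ => Finset.sum_comm

/-- A scheme is correct iff the associated trilinear form is `(X, Y, Z) ↦ tr (X * Y * Z)`. -/
theorem isCorrectScheme_iff_trace {K : Type*} [Field K] {n r : ℕ}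
    (A B C : Fin r → Matrix (Fin n) (Fin n) K) :
    IsCorrectScheme A B C ↔ ∀ X Y Z : Matrix (Fin n) (Fin n) K,
      ∑ l, (∑ i, ∑ j, A l i j * X i j) * (∑ i, ∑ j, B l i j * Y i j) *
        (∑ i, ∑ j, C l i j * Z i j) = trace (X * Y * Z) := by
  refine ⟨fun h X Y Z => ?_, fun h X Y => ?_⟩
  · have trace_eq : trace (X * Y * Z) = ∑ i, ∑ j, (X * Y)ᵀ i j * Z i j := by
      simp only [trace, diag_apply, mul_apply (M := X * Y), transpose_apply]
      exact Finset.sum_comm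
    rw [trace_eq, ← h X Y, sum_smul_sum_sum_mul]
  · ext p q
    simpa [Matrix.sum_apply, sum_sum_mul_single_one, trace_mul_single] using
      h X Y (single p q 1)

/-- Correctness of a matrix multiplication scheme is preserved by the cyclic shift
`(A_l, B_l, C_l) ↦ (B_l, C_l, A_l)`. -/
theorem cyclic_shift_preserves_correctness (K : Type*) [Field K] (n r : ℕ)
    (hn : 1 ≤ n) (hr : 1 ≤ r)
    (A B C : Fin r → Matrix (Fin n) (Fin n) K)
    (h : IsCorrectScheme A B C) :
    IsCorrectScheme B C A := by
  rw [isCorrectScheme_iff_trace] at h ⊢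
  intro X Y Z
  rw [trace_mul_cycle, ← h Z X Y]
  exact Finset.sum_congr rfl fun l _ => by ring
end

section
/- The rank pattern of a matrix multiplication scheme is invariant under the symmetry group up to permutation: if a scheme S' = (A'_l, B'_l, C'_l)_{l=1}^r is obtained from a scheme S = (A_l, B_l, C_l)_{l=1}^r by any finite composition of (i) permutations of the rows, (ii) the cyclic shift (A,B,C) ↦ (B,C,A) applied to every row, (iii) the map (A,B,C) ↦ (Bᵀ,Aᵀ,Cᵀ) applied to every row, and (iv) sandwiching (A,B,C) ↦ (U·A·V⁻¹, V·B·W⁻¹, W·C·U⁻¹) with U,V,W ∈ GL(n,K) applied to every row, then there exist a permutation σ of {1,…,r} and a permutation π of {1,2,3} such that rank(S'_{i,j}) = rank(S_{σ(i),π(j)}) for all i ∈ {1,…,r} and j ∈ {1,2,3}, where S_{i,1} = A_i, S_{i,2} = B_i, S_{i,3} = C_i. -/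
open Matrix

/-- The `j`-th matrix of a row `(A,B,C)` of a scheme: column `0` is `A`, column `1` is `B`,
column `2` is `C`. -/
def rowEntry {K : Type*} [Field K] {n : ℕ}
    (T : Matrix (Fin n) (Fin n) K × Matrix (Fin n) (Fin n) K × Matrix (Fin n) (Fin n) K)
    (j : Fin 3) : Matrix (Fin n) (Fin n) K :=
  ![T.1, T.2.1, T.2.2] j

/-- One elementary symmetry operation on matrix multiplication schemes: (i) a row
permutation, (ii) the cyclic shift `(A,B,C) ↦ (B,C,A)` applied to every row, (iii) the map
`(A,B,C) ↦ (Bᵀ,Aᵀ,Cᵀ)` applied to every row, (iv) sandwiching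
`(A,B,C) ↦ (U·A·V⁻¹, V·B·W⁻¹, W·C·U⁻¹)` with `U,V,W ∈ GL(n,K)` applied to every row. -/
inductive SchemeStep (K : Type*) [Field K] (n r : ℕ) :
    (Fin r → Matrix (Fin n) (Fin n) K × Matrix (Fin n) (Fin n) K × Matrix (Fin n) (Fin n) K) →
    (Fin r → Matrix (Fin n) (Fin n) K × Matrix (Fin n) (Fin n) K × Matrix (Fin n) (Fin n) K) →
    Prop
  | rowPerm (σ : Equiv.Perm (Fin r)) (S) : SchemeStep K n r S (fun l => S (σ l))
  | cyc (S) : SchemeStep K n r S (fun l => ((S l).2.1, (S l).2.2, (S l).1))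
  | transposeSwap (S) : SchemeStep K n r S (fun l => ((S l).2.1ᵀ, (S l).1ᵀ, (S l).2.2ᵀ))
  | sandwich (U V W : GL (Fin n) K) (S) : SchemeStep K n r S
      (fun l =>
        ((U : Matrix (Fin n) (Fin n) K) * (S l).1 *
          ((V⁻¹ : GL (Fin n) K) : Matrix (Fin n) (Fin n) K),
         (V : Matrix (Fin n) (Fin n) K) * (S l).2.1 *
          ((W⁻¹ : GL (Fin n) K) : Matrix (Fin n) (Fin n) K),
         (W : Matrix (Fin n) (Fin n) K) * (S l).2.2 *
          ((U⁻¹ : GL (Fin n) K) : Matrix (Fin n) (Fin n) K)))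

theorem Matrix.rank_units_mul_mul_units {K : Type*} [Field K] {n : ℕ} (U V : GL (Fin n) K)
    (A : Matrix (Fin n) (Fin n) K) :
    ((U : Matrix (Fin n) (Fin n) K) * A * (V : Matrix (Fin n) (Fin n) K)).rank = A.rank := by
  rw [Matrix.rank_mul_eq_left_of_isUnit_det _ _ ((Matrix.isUnit_iff_isUnit_det _).1 V.isUnit),
    Matrix.rank_mul_eq_right_of_isUnit_det _ _ ((Matrix.isUnit_iff_isUnit_det _).1 U.isUnit)]

/-- A single symmetry operation permutes the rows and the columns of the rank pattern. -/
theorem SchemeStep.exists_perm_rank_eq {K : Type*} [Field K] {n r : ℕ}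
    {S S' : Fin r →
      Matrix (Fin n) (Fin n) K × Matrix (Fin n) (Fin n) K × Matrix (Fin n) (Fin n) K}
    (h : SchemeStep K n r S S') :
    ∃ (σ : Equiv.Perm (Fin r)) (π : Equiv.Perm (Fin 3)),
      ∀ (i : Fin r) (j : Fin 3),
        (rowEntry (S' i) j).rank = (rowEntry (S (σ i)) (π j)).rank := by
  cases h with
  | rowPerm σ => exact ⟨σ, 1, fun _ _ => rfl⟩
  | cyc =>
    refine ⟨1, finRotate 3, fun i j => ?_⟩
    fin_cases j <;> rfl
  | transposeSwap =>
    refine ⟨1, Equiv.swap 0 1, fun i j => ?_⟩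
    fin_cases j <;> exact Matrix.rank_transpose _
  | sandwich U V W =>
    refine ⟨1, 1, fun i j => ?_⟩
    fin_cases j <;> exact Matrix.rank_units_mul_mul_units _ _ _

/-- If a scheme `S'` is obtained from a scheme `S` by a finite composition of the symmetry
operations (row permutations, cyclic shift, transpose-swap, sandwiching), then the rank
pattern of `S'` equals the rank pattern of `S` up to a permutation `σ` of the rows and a
permutation `π` of the three columns. -/
theorem rank_pattern_invariant (K : Type*) [Field K] (n r : ℕ) (hn : 1 ≤ n) (hr : 1 ≤ r)
    (S S' : Fin r →
      Matrix (Fin n) (Fin n) K × Matrix (Fin n) (Fin n) K × Matrix (Fin n) (Fin n) K)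
    (h : Relation.ReflTransGen (SchemeStep K n r) S S') :
    ∃ (σ : Equiv.Perm (Fin r)) (π : Equiv.Perm (Fin 3)),
      ∀ (i : Fin r) (j : Fin 3),
        (rowEntry (S' i) j).rank = (rowEntry (S (σ i)) (π j)).rank := by
  induction h with
  | refl => exact ⟨1, 1, fun _ _ => rfl⟩
  | tail _ hstep ih =>
    obtain ⟨σ₁, π₁, h₁⟩ := ih
    obtain ⟨σ₂, π₂, h₂⟩ := hstep.exists_perm_rank_eq
    exact ⟨σ₁ * σ₂, π₁ * π₂, fun i j => (h₂ i j).trans (h₁ (σ₂ i) (π₂ j))⟩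
end

section
/- Over a finite field, the normal form of a matrix multiplication scheme is well defined and characterizes equivalence: let K be a finite field with a linear order on its underlying set, extended to matrices, rows, and schemes as described; let G be the symmetry group acting on schemes by row permutations, column permutations (with transposition of all matrices for odd column permutations), and sandwiching. For a scheme S, the set N(S) = {S' ∈ G·S : the rank pattern of S' is lexicographically maximal among the rank patterns of all elements of G·S} is nonempty and has a unique minimum NF(S) with respect to the linear order on schemes; moreover NF(S) ∈ G·S, and for any two schemes S and T one has G·S = G·T if and only if NF(S) = NF(T). -/
open Matrix

/-- Lexicographic order on column vectors, the top entry being most significant: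
`v < w` iff at the first position where they differ, `v` is smaller. -/
def vecLt {K : Type*} [LinearOrder K] {n : ℕ} (v w : Fin n → K) : Prop :=
  ∃ i : Fin n, v i < w i ∧ ∀ j : Fin n, j < i → v j = w j

/-- Order on `n×n` matrices: `M < M'` iff at the last column where they differ, the column of
`M` is lexicographically smaller (the last column is most significant). -/
def matLt {K : Type*} [LinearOrder K] {n : ℕ} (M M' : Matrix (Fin n) (Fin n) K) : Prop :=
  ∃ j : Fin n, vecLt (fun i => M i j) (fun i => M' i j) ∧
    ∀ k : Fin n, j < k → ∀ i : Fin n, M i k = M' i k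

/-- Nonstrict version of the matrix order. -/
def matLe {K : Type*} [LinearOrder K] {n : ℕ} (M M' : Matrix (Fin n) (Fin n) K) : Prop :=
  matLt M M' ∨ M = M'

/-- Lexicographic order on triples of matrices, the first component being most significant. -/
def tripleLt {K : Type*} [LinearOrder K] {n : ℕ}
    (x y : Matrix (Fin n) (Fin n) K × Matrix (Fin n) (Fin n) K × Matrix (Fin n) (Fin n) K) :
    Prop :=
  matLt x.1 y.1 ∨ (x.1 = y.1 ∧ (matLt x.2.1 y.2.1 ∨ (x.2.1 = y.2.1 ∧ matLt x.2.2 y.2.2)))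

/-- Nonstrict version of the order on triples of matrices. -/
def tripleLe {K : Type*} [LinearOrder K] {n : ℕ}
    (x y : Matrix (Fin n) (Fin n) K × Matrix (Fin n) (Fin n) K × Matrix (Fin n) (Fin n) K) :
    Prop :=
  tripleLt x y ∨ x = y

/-- A triple `(A,B,C)` is minimal in its orbit under the sandwiching action of `GL(n,K)³` if
`(A,B,C) ≤ (U·A·V⁻¹, V·B·W⁻¹, W·C·U⁻¹)` for all `U, V, W ∈ GL(n,K)`. -/
def MinimalInOrbit {K : Type*} [Field K] [LinearOrder K] {n : ℕ}
    (A B C : Matrix (Fin n) (Fin n) K) : Prop :=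
  ∀ U V W : GL (Fin n) K,
    tripleLe (A, B, C)
      ((U : Matrix (Fin n) (Fin n) K) * A * ((V⁻¹ : GL (Fin n) K) : Matrix (Fin n) (Fin n) K),
       (V : Matrix (Fin n) (Fin n) K) * B * ((W⁻¹ : GL (Fin n) K) : Matrix (Fin n) (Fin n) K),
       (W : Matrix (Fin n) (Fin n) K) * C * ((U⁻¹ : GL (Fin n) K) : Matrix (Fin n) (Fin n) K))

/-- An `n×n` matrix `A` is of subdiagonal form of rank `t` if (in `1`-based indexing)
`A_{i,j} = 1` whenever `j ≤ t` and `i = n−t+j`, and `A_{i,j} = 0` otherwise. -/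
def IsSubdiagonalForm {K : Type*} [Field K] {n : ℕ} (t : ℕ)
    (A : Matrix (Fin n) (Fin n) K) : Prop :=
  ∀ i j : Fin n, A i j = if (j : ℕ) < t ∧ (i : ℕ) = n - t + (j : ℕ) then 1 else 0

/-- An `n×n` matrix `B` is in column echelon form if there is an `s` such that all columns
after the first `s` are zero, and for each of the first `s` columns the topmost nonzero entry
equals `1`, the row indices of these topmost nonzero entries being strictly increasing. -/
def IsColumnEchelonForm {K : Type*} [Field K] {n : ℕ}
    (B : Matrix (Fin n) (Fin n) K) : Prop :=
  ∃ s : ℕ, s ≤ n ∧ (∀ j : Fin n, s ≤ (j : ℕ) → ∀ i : Fin n, B i j = 0) ∧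
    ∃ p : Fin n → Fin n,
      (∀ j : Fin n, (j : ℕ) < s → B (p j) j = 1 ∧ ∀ i : Fin n, i < p j → B i j = 0) ∧
      ∀ j k : Fin n, (j : ℕ) < s → (k : ℕ) < s → j < k → p j < p k

/-- Lexicographic order on schemes: rows are compared from top to bottom, each row being a
triple of matrices compared with `tripleLt`. -/
def schemeLt {K : Type*} [LinearOrder K] {n r : ℕ}
    (S T : Fin r →
      Matrix (Fin n) (Fin n) K × Matrix (Fin n) (Fin n) K × Matrix (Fin n) (Fin n) K) : Prop :=
  ∃ i : Fin r, tripleLt (S i) (T i) ∧ ∀ j : Fin r, j < i → S j = T j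

/-- Nonstrict version of the order on schemes. -/
def schemeLe {K : Type*} [LinearOrder K] {n r : ℕ}
    (S T : Fin r →
      Matrix (Fin n) (Fin n) K × Matrix (Fin n) (Fin n) K × Matrix (Fin n) (Fin n) K) : Prop :=
  schemeLt S T ∨ S = T

/-- The rank pattern of a scheme: the `r×3` table of the ranks of its matrices. -/
noncomputable def rankPattern {K : Type*} [Field K] {n r : ℕ}
    (S : Fin r →
      Matrix (Fin n) (Fin n) K × Matrix (Fin n) (Fin n) K × Matrix (Fin n) (Fin n) K)
    (i : Fin r) (j : Fin 3) : ℕ :=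
  (rowEntry (S i) j).rank

/-- Lexicographic comparison of rank patterns: rows from top to bottom, within a row from
left to right. -/
def rankPatternLe {r : ℕ} (P Q : Fin r → Fin 3 → ℕ) : Prop :=
  (∃ i : Fin r, (∃ j : Fin 3, P i j < Q i j ∧ ∀ k : Fin 3, k < j → P i k = Q i k) ∧
    ∀ i' : Fin r, i' < i → P i' = Q i') ∨ P = Q

/-- `T` lies in the orbit `G·S` of `S` under the symmetry group. -/
def InOrbit (K : Type*) [Field K] (n r : ℕ)
    (S T : Fin r →
      Matrix (Fin n) (Fin n) K × Matrix (Fin n) (Fin n) K × Matrix (Fin n) (Fin n) K) : Prop :=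
  Relation.ReflTransGen (SchemeStep K n r) S T

/-- The set `N(S)` of elements of the orbit `G·S` whose rank pattern is lexicographically
maximal among the rank patterns of all elements of `G·S`. -/
def maxRankSet (K : Type*) [Field K] (n r : ℕ)
    (S : Fin r →
      Matrix (Fin n) (Fin n) K × Matrix (Fin n) (Fin n) K × Matrix (Fin n) (Fin n) K) :
    Set (Fin r →
      Matrix (Fin n) (Fin n) K × Matrix (Fin n) (Fin n) K × Matrix (Fin n) (Fin n) K) :=
  {S' | InOrbit K n r S S' ∧
    ∀ S'', InOrbit K n r S S'' → rankPatternLe (rankPattern S'') (rankPattern S')}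

/-- The lexicographic relation on functions indexed by a well-ordered type is a strict total order
whenever the relation on the values is. -/
theorem Pi.Lex.isStrictTotalOrder {ι α : Type*} (r : ι → ι → Prop) [IsWellOrder ι r]
    (s : α → α → Prop) [IsStrictTotalOrder α s] :
    IsStrictTotalOrder (ι → α) (Pi.Lex r (fun {_} => s)) where
  toTrichotomous := Pi.trichotomous_lex r (fun {_} => s) IsWellFounded.wf
  irrefl := fun a ⟨k, _, hk⟩ => irrefl_of s (a k) hk
  trans := by
    rintro a b c ⟨i, hi, hab⟩ ⟨j, hj, hbc⟩
    rcases trichotomous_of r i j with h | rfl | h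
    · exact ⟨i, fun k hk => (hi k hk).trans (hj k (trans_of r hk h)), hj i h ▸ hab⟩
    · exact ⟨i, fun k hk => (hi k hk).trans (hj k hk), trans_of s hab hbc⟩
    · exact ⟨j, fun k hk => (hi k (trans_of r hk h)).trans (hj k hk), (hi j h).symm ▸ hbc⟩

/-- In a finite type with a strict total order, every nonempty set has a minimum. -/
theorem Set.Nonempty.exists_forall_rel_or_eq {α : Type*} [Finite α] (r : α → α → Prop)
    [IsStrictTotalOrder α r] {s : Set α} (hs : s.Nonempty) :
    ∃ m ∈ s, ∀ x ∈ s, r m x ∨ m = x := by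
  obtain ⟨m, hm, hmin⟩ := (Finite.wellFounded_of_trans_of_irrefl r).has_min s hs
  refine ⟨m, hm, fun x hx => ?_⟩
  rcases trichotomous_of r m x with h | h | h
  · exact Or.inl h
  · exact Or.inr h
  · exact absurd h (hmin x hx)

section Order

variable {K : Type*} [LinearOrder K] {n r : ℕ}

instance vecLt.isStrictTotalOrder : IsStrictTotalOrder (Fin n → K) vecLt :=
  have := Pi.Lex.isStrictTotalOrder (ι := Fin n) (· < ·) (fun x y : K => x < y)
  RelEmbedding.isStrictTotalOrder (s := Pi.Lex (· < ·) (fun {_} (x y : K) => x < y))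
    ⟨Function.Embedding.refl _, exists_congr fun _ => and_comm⟩

instance matLt.isStrictTotalOrder :
    IsStrictTotalOrder (Matrix (Fin n) (Fin n) K) matLt :=
  have := Pi.Lex.isStrictTotalOrder (ι := Fin n) (· > ·) (vecLt (K := K) (n := n))
  RelEmbedding.isStrictTotalOrder (s := Pi.Lex (· > ·) (fun {_} => vecLt (K := K) (n := n)))
    ⟨⟨transpose, transpose_injective⟩, exists_congr fun _ => by
      simp only [funext_iff]
      exact and_comm⟩

instance tripleLt.isStrictTotalOrder :
    IsStrictTotalOrder
      (Matrix (Fin n) (Fin n) K × Matrix (Fin n) (Fin n) K × Matrix (Fin n) (Fin n) K)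
      tripleLt where
  trichotomous := by
    rintro ⟨a, b, c⟩ ⟨a', b', c'⟩ h h'
    have ha := trichotomous_of matLt a a'
    have hb := trichotomous_of matLt b b'
    have hc := trichotomous_of matLt c c'
    simp only [tripleLt, Prod.mk.injEq] at h h' ⊢
    grind
  irrefl := by
    rintro ⟨a, b, c⟩ h
    simp [tripleLt, irrefl_of matLt] at h
  trans := by
    rintro ⟨a, b, c⟩ ⟨a', b', c'⟩ ⟨a'', b'', c''⟩ h h'
    have ha := @trans_of _ matLt a a' a'' _
    have hb := @trans_of _ matLt b b' b'' _
    have hc := @trans_of _ matLt c c' c'' _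
    simp only [tripleLt] at h h' ⊢
    grind

instance schemeLt.isStrictTotalOrder :
    IsStrictTotalOrder
      (Fin r → Matrix (Fin n) (Fin n) K × Matrix (Fin n) (Fin n) K × Matrix (Fin n) (Fin n) K)
      schemeLt :=
  have := Pi.Lex.isStrictTotalOrder (ι := Fin r) (· < ·) (tripleLt (K := K) (n := n))
  RelEmbedding.isStrictTotalOrder (s := Pi.Lex (· < ·) (fun {_} => tripleLt (K := K) (n := n)))
    ⟨Function.Embedding.refl _, exists_congr fun _ => and_comm⟩

end Order

/-- A nonempty finite set of tables has a maximum with respect to `rankPatternLe`. -/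
theorem exists_forall_rankPatternLe {r : ℕ} {s : Set (Fin r → Fin 3 → ℕ)} (hfin : s.Finite)
    (hs : s.Nonempty) : ∃ m ∈ s, ∀ x ∈ s, rankPatternLe x m := by
  have := Pi.Lex.isStrictTotalOrder (ι := Fin 3) (· < ·) (fun x y : ℕ => x < y)
  have := Pi.Lex.isStrictTotalOrder (ι := Fin r) (· < ·)
    (Pi.Lex (ι := Fin 3) (· < ·) (fun {_} (x y : ℕ) => x < y))
  let lt : (Fin r → Fin 3 → ℕ) → (Fin r → Fin 3 → ℕ) → Prop :=
    Pi.Lex (· < ·) (fun {_} => Pi.Lex (ι := Fin 3) (· < ·) (fun {_} (x y : ℕ) => x < y))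
  have : Finite s := hfin
  have : IsStrictTotalOrder (Fin r → Fin 3 → ℕ) (Function.swap lt) := inferInstance
  have : IsStrictTotalOrder s (fun x y => lt y x) :=
    RelEmbedding.isStrictTotalOrder (s := Function.swap lt)
      ⟨⟨Subtype.val, Subtype.val_injective⟩, Iff.rfl⟩
  have : Nonempty s := hs.to_subtype
  obtain ⟨⟨m, hm⟩, -, hmax⟩ :=
    Set.univ_nonempty.exists_forall_rel_or_eq (fun x y : s => lt y x)
  refine ⟨m, hm, fun x hx => (hmax ⟨x, hx⟩ trivial).imp ?_ fun h => ?_⟩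
  · rintro ⟨i, hi, j, hj, hlt⟩
    exact ⟨i, ⟨j, hlt, hj⟩, hi⟩
  · exact (congrArg Subtype.val h).symm

section Orbit

variable {K : Type*} [Field K] {n r : ℕ}
  {S T : Fin r → Matrix (Fin n) (Fin n) K × Matrix (Fin n) (Fin n) K × Matrix (Fin n) (Fin n) K}

theorem GL_inv_mul_sandwich_mul_inv_inv (U V : GL (Fin n) K) (A : Matrix (Fin n) (Fin n) K) :
    (↑U⁻¹ : Matrix (Fin n) (Fin n) K) *
        ((U : Matrix (Fin n) (Fin n) K) * A * (↑V⁻¹ : Matrix (Fin n) (Fin n) K)) *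
      (↑(V⁻¹)⁻¹ : Matrix (Fin n) (Fin n) K) = A := by
  rw [Matrix.mul_assoc, Units.mul_inv_cancel_right, Units.inv_mul_cancel_left]

theorem SchemeStep.inOrbit_symm (h : SchemeStep K n r S T) : InOrbit K n r T S := by
  cases h with
  | rowPerm σ =>
    refine .single ?_
    convert SchemeStep.rowPerm σ⁻¹ _ using 2
    simp
  | cyc => exact (Relation.ReflTransGen.single (.cyc _)).tail (.cyc _)
  | transposeSwap =>
    refine .single ?_
    convert SchemeStep.transposeSwap _ using 2
    simp
  | sandwich U V W =>
    refine .single ?_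
    convert SchemeStep.sandwich U⁻¹ V⁻¹ W⁻¹ _ using 2
    simp only [GL_inv_mul_sandwich_mul_inv_inv]

theorem InOrbit.symm (h : InOrbit K n r S T) : InOrbit K n r T S := by
  induction h with
  | refl => exact .refl
  | tail _ hstep ih => exact hstep.inOrbit_symm.trans ih

theorem InOrbit.inOrbit_iff (h : InOrbit K n r S T)
    (X : Fin r → Matrix (Fin n) (Fin n) K × Matrix (Fin n) (Fin n) K × Matrix (Fin n) (Fin n) K) :
    InOrbit K n r S X ↔ InOrbit K n r T X :=
  ⟨h.symm.trans, h.trans⟩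

theorem maxRankSet_congr (h : ∀ X, InOrbit K n r S X ↔ InOrbit K n r T X) :
    maxRankSet K n r S = maxRankSet K n r T := by
  simp only [maxRankSet, h]

theorem maxRankSet_nonempty [Finite K] (S : Fin r →
      Matrix (Fin n) (Fin n) K × Matrix (Fin n) (Fin n) K × Matrix (Fin n) (Fin n) K) :
    (maxRankSet K n r S).Nonempty := by
  have : Finite (Matrix (Fin n) (Fin n) K) := inferInstanceAs (Finite (Fin n → Fin n → K))
  obtain ⟨-, ⟨X, hX, rfl⟩, hmax⟩ := exists_forall_rankPatternLe
    (s := rankPattern '' {X | InOrbit K n r S X}) (Set.toFinite _)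
    ⟨_, S, Relation.ReflTransGen.refl, rfl⟩
  exact ⟨X, hX, fun Y hY => hmax _ ⟨Y, hY, rfl⟩⟩

end Orbit

/-- Over a finite field the normal form of a matrix multiplication scheme is well defined and
characterizes equivalence: the set `N(S)` of orbit elements with lexicographically maximal
rank pattern is nonempty and has a unique minimum `NF(S)` with respect to the order on
schemes; `NF(S)` lies in the orbit of `S`, and two schemes have the same orbit if and only
if they have the same normal form. -/
theorem normal_form_wellDefined (K : Type*) [Field K] [Fintype K] [LinearOrder K]
    (h0 : ∀ x : K, 0 ≤ x) (h1 : ∀ x : K, x ≠ 0 → 1 ≤ x)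
    (n r : ℕ) (hn : 1 ≤ n) (hr : 1 ≤ r) :
    ∃ NF : (Fin r →
        Matrix (Fin n) (Fin n) K × Matrix (Fin n) (Fin n) K × Matrix (Fin n) (Fin n) K) →
      (Fin r →
        Matrix (Fin n) (Fin n) K × Matrix (Fin n) (Fin n) K × Matrix (Fin n) (Fin n) K),
      (∀ S, NF S ∈ maxRankSet K n r S ∧
        (∀ x ∈ maxRankSet K n r S, schemeLe (NF S) x) ∧
        (∀ m ∈ maxRankSet K n r S, (∀ x ∈ maxRankSet K n r S, schemeLe m x) → m = NF S)) ∧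
      (∀ S T, (∀ X, InOrbit K n r S X ↔ InOrbit K n r T X) ↔ NF S = NF T) := by
  have : Finite (Matrix (Fin n) (Fin n) K) := inferInstanceAs (Finite (Fin n → Fin n → K))
  choose NF hmem hmin using fun S =>
    (maxRankSet_nonempty (K := K) (n := n) (r := r) S).exists_forall_rel_or_eq schemeLt
  have huniq : ∀ S, ∀ m ∈ maxRankSet K n r S,
      (∀ x ∈ maxRankSet K n r S, schemeLe m x) → m = NF S := by
    intro S m hm hle
    rcases hle _ (hmem S) with h | h
    · exact (hmin S m hm).elim (fun h' => absurd h' (asymm_of schemeLt h)) Eq.symm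
    · exact h
  refine ⟨NF, fun S => ⟨hmem S, hmin S, huniq S⟩, fun S T => ⟨fun h => ?_, fun h => ?_⟩⟩
  · have heq := maxRankSet_congr h
    exact huniq T _ (heq ▸ hmem S) (heq ▸ hmin S)
  · exact InOrbit.inOrbit_iff ((hmem S).1.trans (h ▸ (hmem T).1.symm))
end

section
/- If a triple (A,B,C) of n×n matrices over K is minimal in its orbit under the sandwiching action of GL(n,K)³ with respect to the order described, then A is of subdiagonal form of rank t = rank(A), i.e., A is the block matrix ((0,0),(I_t,0)); in particular, if rank(A) = n then A = I_n. -/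
open Matrix

/-- If every entry of a matrix outside the rows in `s` and the columns in `c` vanishes, its rank
is at most `#s + #c`. -/
theorem rank_le_card_add_card {K m n : Type*} [Field K] [Fintype m] [Fintype n]
    [DecidableEq m] (A : Matrix m n K) (s : Finset m) (c : Finset n)
    (h : ∀ i ∉ s, ∀ j ∉ c, A i j = 0) : A.rank ≤ s.card + c.card := by
  classical
  set F : Finset (m → K) := s.image (fun i => Pi.single i 1) ∪ c.image A.col
  have hspan : Submodule.span K (Set.range A.col) ≤ Submodule.span K (F : Set (m → K)) := by
    rw [Submodule.span_le]
    rintro _ ⟨j, rfl⟩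
    by_cases hj : j ∈ c
    · exact Submodule.subset_span
        (Finset.mem_union_right _ (Finset.mem_image_of_mem _ hj))
    · rw [pi_eq_sum_univ' (A.col j)]
      refine Submodule.sum_mem _ fun i _ => ?_
      by_cases hi : i ∈ s
      · exact Submodule.smul_mem _ _ (Submodule.subset_span
          (Finset.mem_union_left _ (Finset.mem_image.2 ⟨i, hi, by ext k; simp [Pi.single_apply]⟩)))
      · simp [h i hi j hj]
  calc A.rank = Module.finrank K (Submodule.span K (Set.range A.col)) :=
        A.rank_eq_finrank_span_cols
    _ ≤ Module.finrank K (Submodule.span K (F : Set (m → K))) := Submodule.finrank_mono hspan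
    _ ≤ F.card := finrank_span_finset_le_card F
    _ ≤ _ := (Finset.card_union_le _ _).trans (add_le_add Finset.card_image_le Finset.card_image_le)

/-- The subdiagonal form of rank `t`. -/
def subdiagonal (K : Type*) [Field K] (n t : ℕ) : Matrix (Fin n) (Fin n) K :=
  Matrix.of fun i j => if (j : ℕ) < t ∧ (i : ℕ) = n - t + (j : ℕ) then 1 else 0

/-- The subdiagonal form is a block matrix with an identity block, up to reindexing. -/
theorem exists_subdiagonal_eq_submatrix {K : Type*} [Field K] {n t : ℕ} (ht : t ≤ n) :
    ∃ f g : Fin n ≃ Fin t ⊕ Fin (n - t),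
      subdiagonal K n t = (fromBlocks 1 0 0 0).submatrix f g := by
  let g : Fin t ⊕ Fin (n - t) ≃ Fin n :=
    finSumFinEquiv.trans (finCongr (Nat.add_sub_cancel' ht))
  let f : Fin t ⊕ Fin (n - t) ≃ Fin n :=
    (Equiv.sumComm _ _).trans (finSumFinEquiv.trans (finCongr (Nat.sub_add_cancel ht)))
  refine ⟨f.symm, g.symm, ?_⟩
  have key : (subdiagonal K n t).submatrix f g = fromBlocks 1 0 0 0 := by
    ext (i | i) (j | j)
    · simp [subdiagonal, f, g, Matrix.one_apply, Fin.ext_iff]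
    · simp [subdiagonal, f, g]
    · have := i.2
      simp only [subdiagonal, f, g, submatrix_apply, of_apply, fromBlocks_apply₂₁, Matrix.zero_apply,
        Equiv.trans_apply, Equiv.sumComm_apply, Sum.swap_inr, finSumFinEquiv_apply_left,
        finCongr_apply, Fin.val_cast, Fin.val_castAdd, ite_eq_right_iff, one_ne_zero, imp_false]
      omega
    · simp [subdiagonal, f, g]
  rw [← key]
  ext i j
  simp

/-- Every square matrix can be moved to the subdiagonal form of its rank. -/
theorem exists_mul_mul_inv_eq_subdiagonal {K : Type*} [Field K] {n : ℕ}
    (A : Matrix (Fin n) (Fin n) K) :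
    ∃ U V : GL (Fin n) K,
      (U : Matrix (Fin n) (Fin n) K) * A * ((V⁻¹ : GL (Fin n) K) : Matrix (Fin n) (Fin n) K) =
        subdiagonal K n A.rank := by
  have hnf := A.exists_rank_normal_form
  rw [Fintype.card_fin] at hnf
  obtain ⟨P, Q, e, hP, hQ, hPQ⟩ := hnf
  obtain ⟨f, g, hfg⟩ := exists_subdiagonal_eq_submatrix (K := K) A.rank_le_width
  obtain ⟨U, hU⟩ := (isUnit_submatrix_equiv (f.trans e.symm) (Equiv.refl _)).2 hP
  obtain ⟨V, hV⟩ := (isUnit_submatrix_equiv (Equiv.refl _) (g.trans e.symm)).2 hQ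
  refine ⟨U, V⁻¹, ?_⟩
  calc (U : Matrix (Fin n) (Fin n) K) * A * ((V⁻¹⁻¹ : GL (Fin n) K) : Matrix (Fin n) (Fin n) K)
      = (P * A * Q).submatrix (f.trans e.symm) (g.trans e.symm) := by
        rw [inv_inv, hU, hV]
        rfl
    _ = subdiagonal K n A.rank := by
        rw [hPQ, hfg]
        ext i j
        simp

/-- A matrix smaller than the subdiagonal form of rank `t` has rank less than `t`. -/
theorem rank_lt_of_matLt_subdiagonal {K : Type*} [Field K] [LinearOrder K]
    (h0 : ∀ x : K, 0 ≤ x) (h1 : ∀ x : K, x ≠ 0 → 1 ≤ x) {n t : ℕ} (ht : t ≤ n)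
    {A : Matrix (Fin n) (Fin n) K} (hA : matLt A (subdiagonal K n t)) : A.rank < t := by
  obtain ⟨j, ⟨i, hi, hlt⟩, hgt⟩ := hA
  simp only [subdiagonal, of_apply] at hi hlt hgt
  have hij : (j : ℕ) < t ∧ (i : ℕ) = n - t + j := by
    by_contra h
    rw [if_neg h] at hi
    exact (h0 _).not_gt hi
  rw [if_pos hij] at hi
  have hAij : A i j = 0 := by
    by_contra h
    exact (h1 _ h).not_gt hi
  refine (rank_le_card_add_card A (Finset.Ioi i) (Finset.Iio j) fun k hk l hl => ?_).trans_lt ?_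
  · rw [Finset.mem_Ioi, not_lt] at hk
    rw [Finset.mem_Iio, not_lt] at hl
    rcases hl.eq_or_lt with rfl | hl
    · rcases hk.eq_or_lt with rfl | hk
      · exact hAij
      · rw [hlt k hk, if_neg]
        have : (k : ℕ) < i := hk
        omega
    · rw [hgt l hl, if_neg]
      have : (k : ℕ) ≤ i := hk
      have : (j : ℕ) < l := hl
      omega
  · rw [Fin.card_Ioi, Fin.card_Iio]
    omega

/-- If `(A,B,C)` is minimal in its orbit under the sandwiching action of `GL(n,K)³`, then `A`
is of subdiagonal form of rank `rank A`; in particular, if `rank A = n` then `A = I_n`. -/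
theorem minimal_first_matrix_subdiagonal (K : Type*) [Field K] [LinearOrder K]
    (h0 : ∀ x : K, 0 ≤ x) (h1 : ∀ x : K, x ≠ 0 → 1 ≤ x)
    (n : ℕ) (hn : 1 ≤ n) (A B C : Matrix (Fin n) (Fin n) K)
    (hmin : MinimalInOrbit A B C) :
    IsSubdiagonalForm A.rank A ∧ (A.rank = n → A = 1) := by
  have hA : A = subdiagonal K n A.rank := by
    obtain ⟨U, V, hUV⟩ := exists_mul_mul_inv_eq_subdiagonal A
    have hle := hmin U V 1
    rw [hUV] at hle
    have hnlt : ¬ matLt A (subdiagonal K n A.rank) := fun h =>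
      (rank_lt_of_matLt_subdiagonal h0 h1 A.rank_le_width h).false
    rcases hle with (h | ⟨h, -⟩) | h
    · exact absurd h hnlt
    · exact h
    · exact congrArg Prod.fst h
  have hform : IsSubdiagonalForm A.rank A := fun i j => congrFun (congrFun hA i) j
  refine ⟨hform, fun hr => ?_⟩
  ext i j
  rw [hform i j, hr, Matrix.one_apply]
  simp [Fin.ext_iff]
end

section
/- If a triple (A,B,C) of n×n matrices over K is minimal in its orbit under the sandwiching action of GL(n,K)³ with respect to the order described, then B is in column echelon form. -/
open Matrix

theorem vecLt_asymm {K : Type*} [LinearOrder K] {n : ℕ} {v w : Fin n → K}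
    (h : vecLt v w) : ¬ vecLt w v := by
  rintro ⟨j, hj, hj'⟩
  obtain ⟨i, hi, hi'⟩ := h
  rcases lt_trichotomy i j with h | rfl | h
  · exact hi.ne (hj' i h).symm
  · exact lt_asymm hi hj
  · exact hj.ne (hi' j h).symm

theorem vecLt_irrefl {K : Type*} [LinearOrder K] {n : ℕ} (v : Fin n → K) : ¬ vecLt v v :=
  fun h => vecLt_asymm h h

theorem matLt_asymm {K : Type*} [LinearOrder K] {n : ℕ} {M N : Matrix (Fin n) (Fin n) K}
    (h : matLt M N) : ¬ matLt N M := by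
  rintro ⟨j, hj, hj'⟩
  obtain ⟨i, hi, hi'⟩ := h
  rcases lt_trichotomy i j with h | rfl | h
  · simp only [hi' j h] at hj
    exact vecLt_irrefl _ hj
  · exact vecLt_asymm hi hj
  · simp only [hj' i h] at hi
    exact vecLt_irrefl _ hi

theorem matLt_irrefl {K : Type*} [LinearOrder K] {n : ℕ} (M : Matrix (Fin n) (Fin n) K) :
    ¬ matLt M M :=
  fun h => matLt_asymm h h

/-- The second matrix of a minimal triple cannot be decreased by invertible column operations. -/
theorem MinimalInOrbit.not_matLt_mul {K : Type*} [Field K] [LinearOrder K] {n : ℕ}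
    {A B C : Matrix (Fin n) (Fin n) K} (hmin : MinimalInOrbit A B C)
    {G : Matrix (Fin n) (Fin n) K} (hG : G.det ≠ 0) : ¬ matLt (B * G) B := by
  intro hlt
  have h := hmin 1 1 (Matrix.GeneralLinearGroup.mkOfDetNeZero G hG)⁻¹
  have hB : ((Matrix.GeneralLinearGroup.mkOfDetNeZero G hG : GL (Fin n) K) :
      Matrix (Fin n) (Fin n) K) = G := rfl
  simp only [inv_one, inv_inv, Units.val_one, one_mul, mul_one, hB] at h
  rcases h with (h | ⟨-, h | ⟨h, -⟩⟩) | h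
  · exact matLt_irrefl _ h
  · exact matLt_asymm h hlt
  · rw [← show B = B * G from h] at hlt
    exact matLt_irrefl _ hlt
  · rw [← show B = B * G from congrArg (fun x => x.2.1) h] at hlt
    exact matLt_irrefl _ hlt

/-- The leading entries of the second matrix of a minimal triple are equal to `1`. -/
theorem MinimalInOrbit.leading_eq_one {K : Type*} [Field K] [LinearOrder K]
    (h1 : ∀ x : K, x ≠ 0 → 1 ≤ x) {n : ℕ} {A B C : Matrix (Fin n) (Fin n) K}
    (hmin : MinimalInOrbit A B C) {r k : Fin n} (hr : B r k ≠ 0) (hz : ∀ i < r, B i k = 0) :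
    B r k = 1 := by
  by_contra hne
  refine hmin.not_matLt_mul
    (G := Matrix.diagonal (Function.update 1 k (B r k)⁻¹)) ?_ ⟨k, ⟨r, ?_, ?_⟩, ?_⟩
  · rw [Matrix.det_diagonal, Finset.prod_ne_zero_iff]
    intro i _
    by_cases h : i = k
    · subst h; simpa using hr
    · simp [h]
  · simpa [Matrix.mul_diagonal, hr] using lt_of_le_of_ne (h1 _ hr) (Ne.symm hne)
  · intro i hi
    simp [Matrix.mul_diagonal, hz i hi]
  · intro l hl i
    simp [Matrix.mul_diagonal, hl.ne']

/-- In the second matrix of a minimal triple, every column to the left of a nonzero column has a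
nonzero entry above the leading entry of the latter. -/
theorem MinimalInOrbit.exists_ne_zero_above {K : Type*} [Field K] [LinearOrder K]
    (h0 : ∀ x : K, 0 ≤ x) {n : ℕ} {A B C : Matrix (Fin n) (Fin n) K}
    (hmin : MinimalInOrbit A B C) {r j k : Fin n} (hjk : j < k) (hr : B r k ≠ 0)
    (hz : ∀ i < r, B i k = 0) : ∃ i < r, B i j ≠ 0 := by
  by_contra! hj
  have hpos : 0 < B r k := lt_of_le_of_ne (h0 _) hr.symm
  by_cases hrj : B r j = 0
  · refine hmin.not_matLt_mul (G := Matrix.swap K j k) ?_ ⟨k, ⟨r, ?_, ?_⟩, ?_⟩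
    · exact (Matrix.isUnit_iff_isUnit_det _).1
        (Matrix.GeneralLinearGroup.swap K j k).isUnit |>.ne_zero
    · simpa [Matrix.mul_swap_apply_right, hrj] using hpos
    · intro i hi
      simp [Matrix.mul_swap_apply_right, hj i hi, hz i hi]
    · intro l hl i
      exact Matrix.mul_swap_of_ne (hjk.trans hl).ne' hl.ne' B
  · refine hmin.not_matLt_mul (G := Matrix.transvection j k (-(B r k / B r j))) ?_
      ⟨k, ⟨r, ?_, ?_⟩, ?_⟩
    · simp [Matrix.det_transvection_of_ne _ _ hjk.ne]
    · simpa [hrj] using hpos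
    · intro i hi
      simp [hj i hi]
    · intro l hl i
      exact Matrix.mul_transvection_apply_of_ne _ _ _ _ hl.ne' _ _

/-- If `(A,B,C)` is minimal in its orbit under the sandwiching action of `GL(n,K)³`, then `B`
is in column echelon form. -/
theorem minimal_second_matrix_echelon (K : Type*) [Field K] [LinearOrder K]
    (h0 : ∀ x : K, 0 ≤ x) (h1 : ∀ x : K, x ≠ 0 → 1 ≤ x)
    (n : ℕ) (hn : 1 ≤ n) (A B C : Matrix (Fin n) (Fin n) K)
    (hmin : MinimalInOrbit A B C) :
    IsColumnEchelonForm B := by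
  classical
  have hlead : ∀ j : Fin n, ∃ r : Fin n, (∃ i, B i j ≠ 0) →
      B r j ≠ 0 ∧ ∀ i < r, B i j = 0 := by
    intro j
    by_cases hj : ∃ i, B i j ≠ 0
    · obtain ⟨r, hr, hr'⟩ := wellFounded_lt.has_min {i | B i j ≠ 0} hj
      exact ⟨r, fun _ => ⟨hr, fun i hi => by_contra fun h => hr' i h hi⟩⟩
    · exact ⟨j, fun h => absurd h hj⟩
  choose p hp using hlead
  have hex : ∃ s : ℕ, ∀ j : Fin n, s ≤ (j : ℕ) → ∀ i : Fin n, B i j = 0 :=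
    ⟨n, fun j hj => absurd j.isLt hj.not_gt⟩
  have hnz : ∀ j : Fin n, (j : ℕ) < Nat.find hex → ∃ i, B i j ≠ 0 := by
    intro j hj
    have h := Nat.find_min hex hj
    push Not at h
    obtain ⟨k, hk, hik⟩ := h
    rcases (Fin.le_def.2 hk).eq_or_lt with rfl | hlt
    · exact hik
    · obtain ⟨hr, hz⟩ := hp k hik
      obtain ⟨i, -, hi⟩ := hmin.exists_ne_zero_above h0 hlt hr hz
      exact ⟨i, hi⟩
  refine ⟨Nat.find hex, Nat.find_min' hex fun j hj => absurd j.isLt hj.not_gt,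
    Nat.find_spec hex, p, fun j hj => ?_, fun j k hj hk hjk => ?_⟩
  · obtain ⟨hr, hz⟩ := hp j (hnz j hj)
    exact ⟨hmin.leading_eq_one h1 hr hz, hz⟩
  · obtain ⟨hr, hz⟩ := hp k (hnz k hk)
    obtain ⟨i, hi, hij⟩ := hmin.exists_ne_zero_above h0 hjk hr hz
    exact lt_of_le_of_lt (not_lt.1 fun h => hij ((hp j (hnz j hj)).2 i h)) hi
end

section
/- If a triple (A,B,C) of n×n matrices over K is minimal in its orbit under the sandwiching action of GL(n,K)³ with respect to the order described, and rank(A) < n, then the last column of A is zero and the first row of A is zero. -/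
open Matrix

/-- The first matrix of a minimal triple is minimal among its equivalent matrices. -/
theorem MinimalInOrbit.matLe_fst {K : Type*} [Field K] [LinearOrder K] {n : ℕ}
    {A B C : Matrix (Fin n) (Fin n) K} (h : MinimalInOrbit A B C) (U V : GL (Fin n) K) :
    matLe A ((U : Matrix (Fin n) (Fin n) K) * A * (V : Matrix (Fin n) (Fin n) K)) := by
  have h := h U V⁻¹ 1
  rw [inv_inv] at h
  rcases h with (h | ⟨h, -⟩) | h
  · exact Or.inl h
  · exact Or.inr h
  · exact Or.inr (congrArg Prod.fst h)

/-- A singular matrix can be row-reduced by an invertible matrix that kills the row `i₀`, moves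
the old row `i₀` to some position `k` and leaves all other rows unchanged. -/
theorem exists_GL_mul_eq_of_det_eq_zero {K ι : Type*} [Field K] [Fintype ι] [DecidableEq ι]
    {A : Matrix ι ι K} (hA : A.det = 0) (i₀ : ι) :
    ∃ (k : ι) (U : GL ι K), (U : Matrix ι ι K) * A =
      Matrix.of fun i j => if i = i₀ then 0 else if i = k then A i₀ j else A i j := by
  obtain ⟨u, hu, huA⟩ := Matrix.exists_vecMul_eq_zero_iff.mpr hA
  obtain ⟨k, hk⟩ := Function.ne_iff.mp hu
  have hE : ((1 : Matrix ι ι K).updateRow k u).det ≠ 0 := by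
    have h := Matrix.det_updateRow_sum (1 : Matrix ι ι K) k u
    have hsum : ∑ i, u i • (1 : Matrix ι ι K) i = u := by
      ext j
      simp [Finset.sum_apply, Matrix.one_apply]
    rw [hsum] at h
    simpa [h] using hk
  have hS : ((Equiv.swap i₀ k).permMatrix K).det ≠ 0 := by
    rw [Matrix.det_permutation]
    rcases Int.units_eq_one_or (Equiv.Perm.sign (Equiv.swap i₀ k)) with h | h <;> simp [h]
  refine ⟨k, GeneralLinearGroup.mkOfDetNeZero _ hS * GeneralLinearGroup.mkOfDetNeZero _ hE, ?_⟩
  have hEA : (1 : Matrix ι ι K).updateRow k u * A = A.updateRow k 0 := by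
    rw [Matrix.updateRow_mul, Matrix.one_mul, huA]
  change (Equiv.swap i₀ k).permMatrix K * (1 : Matrix ι ι K).updateRow k u * A = _
  rw [Matrix.mul_assoc, hEA, PEquiv.toMatrix_toPEquiv_mul]
  ext i j
  simp only [Matrix.submatrix_apply, Matrix.of_apply, id, Matrix.updateRow_apply,
    Equiv.swap_apply_def]
  split_ifs <;> simp_all

/-- If `(A,B,C)` is minimal in its orbit under the sandwiching action of `GL(n,K)³` and
`rank A < n`, then the last column of `A` is zero and the first row of `A` is zero. -/
theorem minimal_rank_deficient_zero_border (K : Type*) [Field K] [LinearOrder K]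
    (h0 : ∀ x : K, 0 ≤ x) (h1 : ∀ x : K, x ≠ 0 → 1 ≤ x)
    (n : ℕ) (hn : 1 ≤ n) (A B C : Matrix (Fin n) (Fin n) K)
    (hmin : MinimalInOrbit A B C) (hrank : A.rank < n) :
    (∀ i : Fin n, A i ⟨n - 1, by omega⟩ = 0) ∧ (∀ j : Fin n, A ⟨0, by omega⟩ j = 0) := by
  have hdet : A.det = 0 := by
    by_contra h
    have := Matrix.rank_of_isUnit A
      ((Matrix.isUnit_iff_isUnit_det A).mpr (isUnit_iff_ne_zero.mpr h))
    simp [this] at hrank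
  constructor
  · obtain ⟨k, U, hU⟩ := exists_GL_mul_eq_of_det_eq_zero (A := Aᵀ)
      (by rwa [Matrix.det_transpose]) ⟨n - 1, by omega⟩
    have hV : IsUnit ((U : Matrix (Fin n) (Fin n) K)ᵀ) :=
      (Matrix.isUnit_transpose (A := (U : Matrix (Fin n) (Fin n) K))).mpr U.isUnit
    have hle := hmin.matLe_fst 1 hV.unit
    have hcol : ∀ i, (A * (U : Matrix (Fin n) (Fin n) K)ᵀ) i ⟨n - 1, by omega⟩ = 0 := by
      intro i
      rw [← Matrix.transpose_apply (A * _), Matrix.transpose_mul, Matrix.transpose_transpose, hU]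
      simp
    simp only [Units.val_one, Matrix.one_mul, IsUnit.unit_spec] at hle
    intro i
    rcases hle with ⟨j, ⟨r, hlt, -⟩, heq⟩ | heq
    · rcases lt_or_eq_of_le (show j ≤ ⟨n - 1, by omega⟩ from Fin.le_def.mpr (by simp; omega))
        with hj | rfl
      · rw [heq _ hj, hcol]
      · beta_reduce at hlt
        rw [hcol] at hlt
        exact absurd hlt (h0 _).not_gt
    · rw [heq, hcol]
  · obtain ⟨k, U, hU⟩ := exists_GL_mul_eq_of_det_eq_zero hdet ⟨0, by omega⟩
    have hle := hmin.matLe_fst U 1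
    rw [Units.val_one, Matrix.mul_one, hU] at hle
    intro j
    rcases hle with ⟨c, ⟨r, hlt, heq⟩, -⟩ | heq
    · simp only [Matrix.of_apply] at hlt heq
      split_ifs at hlt with hr hk
      · exact absurd hlt (h0 _).not_gt
      · have hr0 : (⟨0, by omega⟩ : Fin n) < r :=
          lt_of_le_of_ne (Fin.le_def.mpr (Nat.zero_le _)) (Ne.symm hr)
        rw [heq _ hr0, if_pos rfl] at hlt
        exact absurd hlt (h0 _).not_gt
      · exact absurd hlt (lt_irrefl _)
    · rw [heq]
      simp
end

section
/- If a triple (A,B,C) of n×n matrices over K is minimal in its orbit under the sandwiching action of GL(n,K)³ with respect to the order described, and rank(A) = n, then A = I_n and B is of subdiagonal form of rank rank(B), i.e., B is the block matrix ((0,0),(I_t,0)) with t = rank(B). -/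
open Matrix

theorem vecLt_of_forall_ne {K : Type*} [LinearOrder K] {n : ℕ} {v w : Fin n → K} (hne : v ≠ w)
    (h : ∀ i, v i ≠ w i → (∀ k < i, v k = w k) → v i < w i) : vecLt v w := by
  obtain ⟨i, hi, hmin⟩ := wellFounded_lt.has_min {i | v i ≠ w i} (Function.ne_iff.1 hne)
  have heq : ∀ k < i, v k = w k := fun k hk => not_not.1 fun hne' => hmin k hne' hk
  exact ⟨i, h i hi heq, heq⟩

theorem matLt_of_forall_col_ne {K : Type*} [LinearOrder K] {n : ℕ}
    {M N : Matrix (Fin n) (Fin n) K} (hne : M ≠ N)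
    (h : ∀ j, M.col j ≠ N.col j → (∀ k, j < k → M.col k = N.col k) →
      vecLt (M.col j) (N.col j)) : matLt M N := by
  have hex : ∃ j, M.col j ≠ N.col j := by
    by_contra! hall
    exact hne (Matrix.ext fun i j => congrFun (hall j) i)
  obtain ⟨j, hj, hmax⟩ := wellFounded_gt.has_min {j | M.col j ≠ N.col j} hex
  have heq : ∀ k, j < k → M.col k = N.col k := fun k hk => not_not.1 fun hne' => hmax k hne' hk
  exact ⟨j, h j hj heq, fun k hk i => congrFun (heq k hk) i⟩

theorem subdiagonal_apply (K : Type*) [Field K] {n : ℕ} (t : ℕ) (i j : Fin n) :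
    subdiagonal K n t i j = if (j : ℕ) < t ∧ (i : ℕ) = n - t + (j : ℕ) then 1 else 0 := rfl

theorem subdiagonal_self (K : Type*) [Field K] (n : ℕ) : subdiagonal K n n = 1 := by
  ext i j
  simp [subdiagonal_apply, Matrix.one_apply, Fin.ext_iff]

/-- Every square matrix over a field is equivalent to the subdiagonal form of its rank. -/
theorem exists_mul_mul_eq_subdiagonal {K : Type*} [Field K] {n : ℕ}
    (M : Matrix (Fin n) (Fin n) K) :
    ∃ P Q : GL (Fin n) K, (P : Matrix (Fin n) (Fin n) K) * M * Q = subdiagonal K n M.rank := by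
  have hnf := M.exists_rank_normal_form
  rw [Fintype.card_fin] at hnf
  obtain ⟨P, Q, e, hP, hQ, h⟩ := hnf
  have hr : M.rank ≤ n := M.rank_le_width
  let rows : Fin n ≃ Fin M.rank ⊕ Fin (n - M.rank) :=
    (finCongr (by omega)).trans (finSumFinEquiv.symm.trans (Equiv.sumComm _ _))
  let cols : Fin n ≃ Fin M.rank ⊕ Fin (n - M.rank) :=
    (finCongr (by omega)).trans finSumFinEquiv.symm
  have hS : subdiagonal K n M.rank = (Matrix.fromBlocks 1 0 0 0).submatrix rows cols := by
    ext i j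
    obtain ⟨x, rfl⟩ := rows.symm.surjective i
    obtain ⟨y, rfl⟩ := cols.symm.surjective j
    rw [Matrix.submatrix_apply, Equiv.apply_symm_apply, Equiv.apply_symm_apply, subdiagonal_apply]
    rcases x with x | x <;> rcases y with y | y
    · simp [rows, cols, Matrix.one_apply, Fin.ext_iff]
    · simp [rows, cols]
    · have := x.isLt
      simp [rows, cols, show (x : ℕ) ≠ n - M.rank + y by omega]
    · simp [rows, cols]
  have hP' : IsUnit (P.submatrix (rows.trans e.symm) (Equiv.refl _)) :=
    (Matrix.isUnit_submatrix_equiv _ _).2 hP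
  have hQ' : IsUnit (Q.submatrix (Equiv.refl _) (cols.trans e.symm)) :=
    (Matrix.isUnit_submatrix_equiv _ _).2 hQ
  refine ⟨hP'.unit, hQ'.unit, ?_⟩
  calc P.submatrix (rows.trans e.symm) id * M * Q.submatrix id (cols.trans e.symm)
      = (P * M * Q).submatrix (rows.trans e.symm) (cols.trans e.symm) := rfl
    _ = subdiagonal K n M.rank := by
      rw [h, hS, Matrix.submatrix_submatrix]
      congr 1 <;> ext x <;> simp

/-- If the columns of `M` after the `j`-th agree with the subdiagonal form of rank `t` and the
`j`-th column vanishes down to the row of its would-be pivot, then `M` has rank less than `t`. -/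
theorem rank_lt_of_cols {K : Type*} [Field K] {n t : ℕ} {M : Matrix (Fin n) (Fin n) K}
    (ht : t ≤ n) {j : Fin n} (hj : (j : ℕ) < t)
    (hcol : ∀ k, j < k → M.col k = (subdiagonal K n t).col k)
    (hzero : ∀ i : Fin n, (i : ℕ) ≤ n - t + j → M i j = 0) : M.rank < t := by
  classical
  let s : Finset (Fin n) := (Finset.univ.filter fun k : Fin n => (k : ℕ) < t).erase j
  have hs : s.card < t := by
    have h : s.card < _ :=
      Finset.card_erase_lt_of_mem (Finset.mem_filter.2 ⟨Finset.mem_univ j, hj⟩)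
    exact h.trans_le (by simp [Fin.card_filter_val_lt])
  have hspan : ∀ k : Fin n, (k : ℕ) < t → k ≠ j →
      M.col k ∈ Submodule.span K (s.image M.col : Set (Fin n → K)) := fun k hk hkj =>
    Submodule.subset_span (Finset.mem_coe.2 (Finset.mem_image_of_mem _ (by simp [s, hk, hkj])))
  have hspanj : M.col j ∈ Submodule.span K (s.image M.col : Set (Fin n → K)) := by
    rw [pi_eq_sum_univ' (M.col j)]
    refine Submodule.sum_mem _ fun i _ => ?_
    rcases le_or_gt (i : ℕ) (n - t + j) with hi | hi
    · simp [hzero i hi]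
    · refine Submodule.smul_mem _ _ ?_
      have hin := i.isLt
      let k : Fin n := ⟨i - (n - t), by omega⟩
      have hjk : j < k := Fin.lt_def.2 (by simp only [k]; omega)
      have hk : M.col k = Pi.single i 1 := by
        rw [hcol k hjk]
        ext l
        simp only [Matrix.col_apply, subdiagonal_apply, Pi.single_apply, Fin.ext_iff, k]
        congr 1
        apply propext
        omega
      exact hk ▸ hspan k (by simp only [k]; omega) hjk.ne'
  have hle : Submodule.span K (Set.range M.col) ≤
      Submodule.span K (s.image M.col : Set (Fin n → K)) := by
    rw [Submodule.span_le]
    rintro _ ⟨k, rfl⟩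
    rcases lt_or_ge (k : ℕ) t with hk | hk
    · rcases eq_or_ne k j with rfl | hkj
      · exact hspanj
      · exact hspan k hk hkj
    · have hk0 : M.col k = 0 := by
        rw [hcol k (Fin.lt_def.2 (by omega))]
        ext i
        simp [subdiagonal_apply, hk.not_gt]
      rw [hk0]
      exact Submodule.zero_mem _
  rw [M.rank_eq_finrank_span_cols]
  calc Module.finrank K (Submodule.span K (Set.range M.col))
      ≤ (s.image M.col).card :=
        (Submodule.finrank_mono hle).trans (finrank_span_finset_le_card _)
    _ ≤ s.card := Finset.card_image_le
    _ < t := hs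

/-- The subdiagonal form is the least matrix of its rank. -/
theorem matLe_subdiagonal_rank {K : Type*} [Field K] [LinearOrder K]
    (h0 : ∀ x : K, 0 ≤ x) (h1 : ∀ x : K, x ≠ 0 → 1 ≤ x) {n : ℕ}
    (M : Matrix (Fin n) (Fin n) K) : matLe (subdiagonal K n M.rank) M := by
  refine or_iff_not_imp_right.2 fun hne => matLt_of_forall_col_ne hne fun j hj heq => ?_
  refine vecLt_of_forall_ne hj fun i hi hlt => ?_
  simp only [Matrix.col_apply, subdiagonal_apply] at hi hlt ⊢
  split_ifs at hi ⊢ with hij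
  · refine (h1 _ fun hz => ?_).lt_of_ne hi
    refine (rank_lt_of_cols M.rank_le_width hij.1 (fun k hk => (heq k hk).symm)
      fun k hk => ?_).false
    rcases (Fin.le_def.2 (hk.trans_eq hij.2.symm)).eq_or_lt with rfl | hki
    · exact hz
    · rw [← hlt k hki, if_neg]
      rintro ⟨-, hk'⟩
      exact hki.ne (Fin.ext (hk'.trans hij.2.symm))
  · exact (h0 _).lt_of_ne hi

theorem eq_subdiagonal_of_matLe {K : Type*} [Field K] [LinearOrder K]
    (h0 : ∀ x : K, 0 ≤ x) (h1 : ∀ x : K, x ≠ 0 → 1 ≤ x) {n : ℕ}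
    {M : Matrix (Fin n) (Fin n) K} (h : matLe M (subdiagonal K n M.rank)) :
    M = subdiagonal K n M.rank := by
  rcases h with h | h
  · rcases matLe_subdiagonal_rank h0 h1 M with h' | h'
    · exact absurd h' (matLt_asymm h)
    · exact h'.symm
  · exact h

theorem MinimalInOrbit.matLe_left {K : Type*} [Field K] [LinearOrder K] {n : ℕ}
    {A B C : Matrix (Fin n) (Fin n) K} (h : MinimalInOrbit A B C) (P Q : GL (Fin n) K) :
    matLe A ((P : Matrix (Fin n) (Fin n) K) * A * Q) := by
  have h' := h P Q⁻¹ 1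
  rw [inv_inv] at h'
  rcases h' with (h' | ⟨h', -⟩) | h'
  · exact .inl h'
  · exact .inr h'
  · exact .inr (congrArg Prod.fst h')

theorem MinimalInOrbit.matLe_middle {K : Type*} [Field K] [LinearOrder K] {n : ℕ}
    {B C : Matrix (Fin n) (Fin n) K} (h : MinimalInOrbit 1 B C) (P Q : GL (Fin n) K) :
    matLe B ((P : Matrix (Fin n) (Fin n) K) * B * Q) := by
  have h' := h P P Q⁻¹
  rw [inv_inv, mul_one, Units.mul_inv] at h'
  rcases h' with (h' | ⟨-, h' | ⟨h', -⟩⟩) | h'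
  · exact absurd h' (matLt_irrefl _)
  · exact .inl h'
  · exact .inr h'
  · exact .inr (congrArg (fun x => x.2.1) h')

/-- If `(A,B,C)` is minimal in its orbit under the sandwiching action of `GL(n,K)³` and
`rank A = n`, then `A = I_n` and `B` is of subdiagonal form of rank `rank B`. -/
theorem minimal_full_rank_first (K : Type*) [Field K] [LinearOrder K]
    (h0 : ∀ x : K, 0 ≤ x) (h1 : ∀ x : K, x ≠ 0 → 1 ≤ x)
    (n : ℕ) (hn : 1 ≤ n) (A B C : Matrix (Fin n) (Fin n) K)
    (hmin : MinimalInOrbit A B C) (hrank : A.rank = n) :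
    A = 1 ∧ IsSubdiagonalForm B.rank B := by
  obtain ⟨P, Q, hPQ⟩ := exists_mul_mul_eq_subdiagonal A
  have hA : A = 1 := by
    have h := eq_subdiagonal_of_matLe h0 h1 (hPQ ▸ hmin.matLe_left P Q)
    rwa [hrank, subdiagonal_self] at h
  subst hA
  obtain ⟨P, Q, hPQ⟩ := exists_mul_mul_eq_subdiagonal B
  have hB := eq_subdiagonal_of_matLe h0 h1 (hPQ ▸ hmin.matLe_middle P Q)
  exact ⟨rfl, fun i j => congrFun (congrFun hB i) j⟩
end

section
/- If a triple (A,B,C) of n×n matrices over K is minimal in its orbit under the sandwiching action of GL(n,K)³ with respect to the order described, and rank(A) = rank(B) = n, then A = I_n, B = I_n, and C ≤ W·C·W⁻¹ for every W ∈ GL(n,K); moreover, the stabilizer of (I_n, I_n, C) under the sandwiching action is exactly the set of triples (W,W,W) with W ∈ GL(n,K) and W·C·W⁻¹ = C. -/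
open Matrix

/-- Vectors that differ have a first index where they differ. -/
theorem exists_first_ne {K : Type*} {n : ℕ} {v w : Fin n → K} (h : v ≠ w) :
    ∃ i, v i ≠ w i ∧ ∀ j < i, v j = w j := by
  obtain ⟨i, hi, hmin⟩ := WellFounded.has_min (wellFounded_lt (α := Fin n))
    {i | v i ≠ w i} (Function.ne_iff.mp h)
  exact ⟨i, hi, fun j hj => not_not.mp fun hne => hmin j hne hj⟩

/-- Matrices that differ have a last column where they differ. -/
theorem exists_last_col_ne {K : Type*} {n : ℕ} {M N : Matrix (Fin n) (Fin n) K} (h : M ≠ N) :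
    ∃ j, M.col j ≠ N.col j ∧ ∀ k, j < k → M.col k = N.col k := by
  have hne : ∃ j, M.col j ≠ N.col j := by
    by_contra! hcol
    exact h (Matrix.ext fun i j => congrFun (hcol j) i)
  obtain ⟨j, hj, hmax⟩ := WellFounded.has_min (wellFounded_gt (α := Fin n))
    {j | M.col j ≠ N.col j} hne
  exact ⟨j, hj, fun k hk => not_not.mp fun hne => hmax k hne hk⟩

/-- The identity is the smallest invertible matrix. -/
theorem one_matLt_of_isUnit {K : Type*} [Field K] [LinearOrder K]
    (h0 : ∀ x : K, 0 ≤ x) (h1 : ∀ x : K, x ≠ 0 → 1 ≤ x) {n : ℕ}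
    {M : Matrix (Fin n) (Fin n) K} (hM : IsUnit M) (hne : M ≠ 1) : matLt 1 M := by
  obtain ⟨j, hj, hcol⟩ := exists_last_col_ne hne
  obtain ⟨i, hi, hfirst⟩ := exists_first_ne hj
  have hentry : ∀ k, j < k → ∀ l, M l k = (1 : Matrix (Fin n) (Fin n) K) l k :=
    fun k hk l => congrFun (hcol k hk) l
  simp only [Matrix.col_apply] at hi hfirst
  refine ⟨j, ⟨i, ?_, fun k hk => (hfirst k hk).symm⟩, fun k hk l => (hentry k hk l).symm⟩
  change (1 : Matrix (Fin n) (Fin n) K) i j < M i j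
  by_cases hij : i = j
  · subst hij
    rw [Matrix.one_apply_eq] at hi ⊢
    refine lt_of_le_of_ne (h1 _ fun hzero => ?_) hi.symm
    have hfix : M *ᵥ M.col i = M.col i := by
      conv_rhs => rw [← Matrix.one_mulVec (M.col i)]
      ext l
      simp only [Matrix.mulVec, dotProduct]
      refine Finset.sum_congr rfl fun k _ => ?_
      rcases lt_trichotomy k i with hk | rfl | hk
      · simp [Matrix.col_apply, hfirst k hk, Matrix.one_apply_ne hk.ne]
      · simp [Matrix.col_apply, hzero]
      · rw [hentry k hk l]
    rw [← Matrix.mulVec_single_one] at hfix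
    have hcontr := congrFun (Matrix.mulVec_injective_of_isUnit hM hfix) i
    rw [Matrix.mulVec_single_one, Matrix.col_apply, hzero] at hcontr
    simp at hcontr
  · rw [Matrix.one_apply_ne hij] at hi ⊢
    exact lt_of_le_of_ne (h0 _) hi.symm

theorem isUnit_of_rank_eq {K : Type*} [Field K] {n : ℕ} {M : Matrix (Fin n) (Fin n) K}
    (h : M.rank = n) : IsUnit M := by
  rw [← Matrix.mulVec_surjective_iff_isUnit]
  have hrange : LinearMap.range M.mulVecLin = ⊤ :=
    Submodule.eq_top_of_finrank_eq (by rw [← Matrix.rank, h, Module.finrank_fin_fun])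
  exact LinearMap.range_eq_top.mp hrange

/-- If `(A,B,C)` is minimal in its orbit under the sandwiching action of `GL(n,K)³` and
`rank A = rank B = n`, then `A = I_n`, `B = I_n`, `C ≤ W·C·W⁻¹` for every `W ∈ GL(n,K)`, and
the stabilizer of `(I_n, I_n, C)` under the sandwiching action consists exactly of the triples
`(W,W,W)` with `W·C·W⁻¹ = C`. -/
theorem minimal_full_rank_both (K : Type*) [Field K] [LinearOrder K]
    (h0 : ∀ x : K, 0 ≤ x) (h1 : ∀ x : K, x ≠ 0 → 1 ≤ x)
    (n : ℕ) (hn : 1 ≤ n) (A B C : Matrix (Fin n) (Fin n) K)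
    (hmin : MinimalInOrbit A B C) (hrankA : A.rank = n) (hrankB : B.rank = n) :
    A = 1 ∧ B = 1 ∧
    (∀ W : GL (Fin n) K,
      matLe C ((W : Matrix (Fin n) (Fin n) K) * C *
        ((W⁻¹ : GL (Fin n) K) : Matrix (Fin n) (Fin n) K))) ∧
    (∀ U V W : GL (Fin n) K,
      ((U : Matrix (Fin n) (Fin n) K) * A * ((V⁻¹ : GL (Fin n) K) : Matrix (Fin n) (Fin n) K) = A ∧
       (V : Matrix (Fin n) (Fin n) K) * B * ((W⁻¹ : GL (Fin n) K) : Matrix (Fin n) (Fin n) K) = B ∧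
       (W : Matrix (Fin n) (Fin n) K) * C * ((U⁻¹ : GL (Fin n) K) : Matrix (Fin n) (Fin n) K) = C)
      ↔ (U = V ∧ V = W ∧
          (W : Matrix (Fin n) (Fin n) K) * C *
            ((W⁻¹ : GL (Fin n) K) : Matrix (Fin n) (Fin n) K) = C)) := by
  have hA := isUnit_of_rank_eq hrankA
  have hB := isUnit_of_rank_eq hrankB
  have hAB : A = 1 ∧ B = 1 := by
    have h := hmin hA.unit⁻¹ 1 hB.unit
    have hA' : ((hA.unit⁻¹ : GL (Fin n) K) : Matrix (Fin n) (Fin n) K) * A = 1 :=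
      hA.val_inv_mul
    have hB' : B * ((hB.unit⁻¹ : GL (Fin n) K) : Matrix (Fin n) (Fin n) K) = 1 :=
      hB.mul_val_inv
    simp only [hA', hB', inv_one, Units.val_one, one_mul, mul_one, tripleLe, tripleLt,
      Prod.mk.injEq] at h
    have key : ∀ {M : Matrix (Fin n) (Fin n) K}, IsUnit M → matLt M 1 → M = 1 :=
      fun hM hlt => by_contra fun hne => matLt_asymm hlt (one_matLt_of_isUnit h0 h1 hM hne)
    have hA1 : A = 1 := by
      rcases h with (h | h) | h
      exacts [key hA h, h.1, h.1]
    refine ⟨hA1, ?_⟩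
    rcases h with (h | ⟨-, h | h⟩) | h
    exacts [(matLt_irrefl _ (hA1 ▸ h)).elim, key hB h, h.1, h.2.1]
  obtain ⟨rfl, rfl⟩ := hAB
  refine ⟨rfl, rfl, fun W => ?_, fun U V W => ?_⟩
  · simpa [tripleLe, tripleLt, matLe, matLt_irrefl] using hmin W W W
  · have heq : ∀ X Y : GL (Fin n) K, (X : Matrix (Fin n) (Fin n) K) * 1 *
        ((Y⁻¹ : GL (Fin n) K) : Matrix (Fin n) (Fin n) K) = 1 ↔ X = Y := fun X Y => by
      rw [mul_one, ← Units.val_mul, Units.val_eq_one, mul_inv_eq_one]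
    rw [heq, heq]
    constructor
    · rintro ⟨rfl, rfl, h⟩
      exact ⟨rfl, rfl, h⟩
    · rintro ⟨rfl, rfl, h⟩
      exact ⟨rfl, rfl, h⟩
end
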